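/- Structure-reproducing property of the additive multi-index kernel (key identity in the proof of Lemma 4, stated for E = Id). Let g : ℝ → ℝ be integrable with support in [−1/2,1/2] and ∫ g(x)dx = 1, let I = (I₁,…,I_k) be a partition of {1,…,d}, and let h ∈ (0,∞)^d. Let f_i : ℝ^{|I_i|} → ℝ, i = 1,…,k, be bounded measurable functions and F(t) = Σ_{i=1}^k f_i(t_{(i)}), where t_{(i)} = (t_j)_{j∈I_i}. Then for every x ∈ ℝ^d, ∫_{ℝ^d} K_{(I,Id,h)}(t − x) F(t) dt = Σ_{i=1}^k ∫_{ℝ^{|I_i|}} [ ∏_{j∈I_i} h_j^{-1} g((t_j − x_j)/h_j) ] f_i(t_{(i)}) dt_{(i)}; i.e. all cross terms and the correction term cancel, and the kernel smooths each additive component only in its own coordinates. -/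

import Mathlib

open MeasureTheory

noncomputable section

/-- `G₀(t) = ∏_{i=1}^d g(t_i)`. -/
def G0 {d : ℕ} (g : ℝ → ℝ) (t : Fin d → ℝ) : ℝ := ∏ i, g (t i)

/-- `G_{i,h}(t) = ∏_{j∈I_i} h_j⁻¹ g(t_j/h_j) · ∏_{j∉I_i} g(t_j)` for a block `I` of the
partition. -/
def Gblock {d : ℕ} (g : ℝ → ℝ) (I : Finset (Fin d)) (h : Fin d → ℝ) (t : Fin d → ℝ) : ℝ :=
  (∏ j ∈ I, (h j)⁻¹ * g (t j / h j)) * ∏ j ∈ Iᶜ, g (t j)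

/-- The additive multi-index kernel
`K_{(I,E,h)}(t) = |det E| [ Σ_{i=1}^k G_{i,h}(Eᵀt) − (k−1) G₀(Eᵀt) ]`. -/
def addKernel {d k : ℕ} (g : ℝ → ℝ) (I : Fin k → Finset (Fin d))
    (E : Matrix (Fin d) (Fin d) ℝ) (h : Fin d → ℝ) (t : Fin d → ℝ) : ℝ :=
  |E.det| *
    ((∑ i, Gblock g (I i) h (E.transpose.mulVec t)) - ((k : ℝ) - 1) * G0 g (E.transpose.mulVec t))

/-- `I` is a partition of `{1,…,d}` into `k` nonempty sets. -/
def IsPartition {d k : ℕ} (I : Fin k → Finset (Fin d)) : Prop :=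
  (∀ i, (I i).Nonempty) ∧ (∀ i j, i ≠ j → Disjoint (I i) (I j)) ∧
    Finset.univ.biUnion I = Finset.univ

/-- The one-dimensional factor in coordinate `j` of the block kernel for `S` centred at `x`. -/
def blockFactor {d : ℕ} (g : ℝ → ℝ) (S : Finset (Fin d)) (h x : Fin d → ℝ) (j : Fin d) (s : ℝ) :
    ℝ :=
  if j ∈ S then (h j)⁻¹ * g ((s - x j) / h j) else g (s - x j)

theorem integrable_prod_mul_restrict {ι : Type*} [Fintype ι] (S : Finset ι)
    {ψ : ι → ℝ → ℝ} (hψ : ∀ j, Integrable (ψ j)) {φ : (S → ℝ) → ℝ} (hφ : Measurable φ)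
    (hb : ∃ C : ℝ, ∀ u, |φ u| ≤ C) :
    Integrable fun t : ι → ℝ => (∏ j, ψ j (t j)) * φ fun j => t j.1 := by
  obtain ⟨C, hC⟩ := hb
  refine (Integrable.fintype_prod hψ).mul_bdd (c := C) ?_ (.of_forall fun t => hC _)
  exact (hφ.comp (measurable_pi_lambda _ fun j => measurable_pi_apply j.1)).aestronglyMeasurable

/-- Integrating out the coordinates outside `S` against factors of unit mass. -/
theorem integral_prod_mul_restrict {ι : Type*} [Fintype ι] (S : Finset ι)
    {ψ : ι → ℝ → ℝ} (hone : ∀ j, ∫ s, ψ j s = 1) (φ : (S → ℝ) → ℝ) :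
    (∫ t : ι → ℝ, (∏ j, ψ j (t j)) * φ fun j => t j.1)
      = ∫ u : S → ℝ, (∏ j : S, ψ j.1 (u j)) * φ u := by
  classical
  have key := (volume_preserving_piEquivPiSubtypeProd (fun _ : ι => ℝ) (· ∈ S)).integral_comp'
    (fun z : ({j // j ∈ S} → ℝ) × ({j // j ∉ S} → ℝ) =>
      ((∏ j : {j // j ∈ S}, ψ j.1 (z.1 j)) * φ z.1) * ∏ j : {j // j ∉ S}, ψ j.1 (z.2 j))
  rw [Measure.volume_eq_prod, integral_prod_mul
    (fun u : {j // j ∈ S} → ℝ => (∏ j : {j // j ∈ S}, ψ j.1 (u j)) * φ u)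
    (fun v : {j // j ∉ S} → ℝ => ∏ j : {j // j ∉ S}, ψ j.1 (v j)),
    integral_fintype_prod_volume_eq_prod (fun j : {j // j ∉ S} => ψ j.1)] at key
  simp only [hone, Finset.prod_const_one, mul_one] at key
  rw [Subsingleton.elim (Subtype.fintype (· ∈ S)) (Finset.Subtype.fintype S)] at key
  refine Eq.trans (integral_congr_ae (.of_forall fun t => ?_)) key
  have hsplit := Fintype.prod_subtype_mul_prod_subtype (· ∈ S) fun j => ψ j (t j)
  simp only [MeasurableEquiv.piEquivPiSubtypeProd, MeasurableEquiv.coe_mk,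
    Equiv.piEquivPiSubtypeProd_apply]
  rw [← hsplit, mul_right_comm]
  congr!

theorem Gblock_sub_eq_prod {d : ℕ} (g : ℝ → ℝ) (S : Finset (Fin d)) (h x t : Fin d → ℝ) :
    Gblock g S h (t - x) = ∏ j, blockFactor g S h x j (t j) := by
  rw [Gblock, ← Finset.prod_mul_prod_compl S]
  congr 1 <;> refine Finset.prod_congr rfl fun j hj => ?_
  · simp [blockFactor, hj]
  · simp [blockFactor, Finset.mem_compl.1 hj]

theorem integrable_blockFactor {d : ℕ} {g : ℝ → ℝ} (hg : Integrable g) (S : Finset (Fin d))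
    {h : Fin d → ℝ} (hh : ∀ j, 0 < h j) (x : Fin d → ℝ) (j : Fin d) :
    Integrable (blockFactor g S h x j) := by
  unfold blockFactor
  split_ifs
  · exact ((hg.comp_div (hh j).ne').comp_sub_right (x j)).const_mul _
  · exact hg.comp_sub_right (x j)

theorem integral_blockFactor {d : ℕ} {g : ℝ → ℝ} (hg : ∫ s, g s = 1) (S : Finset (Fin d))
    {h : Fin d → ℝ} (hh : ∀ j, 0 < h j) (x : Fin d → ℝ) (j : Fin d) :
    ∫ s, blockFactor g S h x j s = 1 := by
  unfold blockFactor
  split_ifs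
  · rw [integral_const_mul, integral_sub_right_eq_self (fun s => g (s / h j)),
      Measure.integral_comp_div, hg, abs_of_pos (hh j), smul_eq_mul, mul_one,
      inv_mul_cancel₀ (hh j).ne']
  · rw [integral_sub_right_eq_self g, hg]

theorem addKernel_one {d k : ℕ} (g : ℝ → ℝ) (I : Fin k → Finset (Fin d)) (h t : Fin d → ℝ) :
    addKernel g I (1 : Matrix (Fin d) (Fin d) ℝ) h t
      = (∑ i, Gblock g (I i) h t) - ((k : ℝ) - 1) * Gblock g ∅ h t := by
  simp [addKernel, G0, Gblock]

/-- **Structure-reproducing property of the additive multi-index kernel** (key identity in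
the proof of Lemma 4, for `E = Id`). For `F(t) = Σ_i f_i(t_{(i)})` with bounded measurable
components, convolving with `K_{(I,Id,h)}` smooths each additive component only in its own
block of coordinates:
`∫ K_{(I,Id,h)}(t−x) F(t) dt = Σ_i ∫ [∏_{j∈I_i} h_j⁻¹ g((t_j−x_j)/h_j)] f_i(t_{(i)}) dt_{(i)}`. -/
theorem addKernel_structure_reproducing
    (d k : ℕ) (hd : 1 ≤ d)
    (g : ℝ → ℝ) (hg_int : Integrable g)
    (hg_supp : Function.support g ⊆ Set.Icc (-(1/2) : ℝ) (1/2))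
    (hg_one : (∫ x, g x) = 1)
    (I : Fin k → Finset (Fin d)) (hI : IsPartition I)
    (h : Fin d → ℝ) (hh : ∀ j, 0 < h j)
    (f : (i : Fin k) → (↥(I i) → ℝ) → ℝ)
    (hfmeas : ∀ i, Measurable (f i))
    (hfbdd : ∀ i, ∃ C : ℝ, ∀ u, |f i u| ≤ C)
    (F : (Fin d → ℝ) → ℝ)
    (hF : ∀ t, F t = ∑ i, f i (fun j => t j.1)) :
    ∀ x : Fin d → ℝ,
      (∫ t, addKernel g I (1 : Matrix (Fin d) (Fin d) ℝ) h (t - x) * F t)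
        = ∑ i, ∫ u : ↥(I i) → ℝ,
            (∏ j : ↥(I i), (h j.1)⁻¹ * g ((u j - x j.1) / h j.1)) * f i u := by
  intro x
  have hint : ∀ (S : Finset (Fin d)) (i : Fin k),
      Integrable fun t => Gblock g S h (t - x) * f i fun j => t j.1 := fun S i => by
    simp only [Gblock_sub_eq_prod]
    exact integrable_prod_mul_restrict (I i) (integrable_blockFactor hg_int S hh x)
      (hfmeas i) (hfbdd i)
  have hval : ∀ (S : Finset (Fin d)) (i : Fin k),
      (∫ t, Gblock g S h (t - x) * f i fun j => t j.1)
        = ∫ u : ↥(I i) → ℝ, (∏ j : ↥(I i), blockFactor g S h x j.1 (u j)) * f i u := fun S i => by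
    simp only [Gblock_sub_eq_prod]
    exact integral_prod_mul_restrict (I i) (integral_blockFactor hg_one S hh x) (f i)
  have hdiag : ∀ i, (∫ t, Gblock g (I i) h (t - x) * f i fun j => t j.1)
      = ∫ u : ↥(I i) → ℝ, (∏ j : ↥(I i), (h j.1)⁻¹ * g ((u j - x j.1) / h j.1)) * f i u := by
    intro i
    simp [hval, blockFactor]
  have hcross : ∀ i l, l ≠ i → (∫ t, Gblock g (I l) h (t - x) * f i fun j => t j.1)
      = ∫ t, Gblock g ∅ h (t - x) * f i fun j => t j.1 := by
    intro i l hl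
    have hnot : ∀ j : ↥(I i), j.1 ∉ I l := fun j =>
      Finset.disjoint_right.1 (hI.2.1 l i hl) j.2
    simp [hval, blockFactor, hnot]
  have hexpand : ∀ t, addKernel g I (1 : Matrix (Fin d) (Fin d) ℝ) h (t - x) * F t
      = ∑ i, ((∑ l, Gblock g (I l) h (t - x) * f i fun j => t j.1)
          - ((k : ℝ) - 1) * (Gblock g ∅ h (t - x) * f i fun j => t j.1)) := by
    intro t
    rw [addKernel_one, hF, Finset.mul_sum]
    exact Finset.sum_congr rfl fun i _ => by rw [sub_mul, Finset.sum_mul, mul_assoc]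
  simp only [hexpand]
  have hsum : ∀ i, Integrable fun t => ∑ l, Gblock g (I l) h (t - x) * f i fun j => t j.1 :=
    fun i => integrable_finsetSum _ fun l _ => hint (I l) i
  have hcorr : ∀ i, Integrable fun t =>
      ((k : ℝ) - 1) * (Gblock g ∅ h (t - x) * f i fun j => t j.1) :=
    fun i => (hint ∅ i).const_mul _
  rw [integral_finsetSum]
  swap
  · exact fun i _ => (hsum i).sub (hcorr i)
  refine Finset.sum_congr rfl fun i _ => ?_
  rw [integral_sub (hsum i) (hcorr i),
    integral_finsetSum _ fun l _ => hint (I l) i, integral_const_mul, ← hdiag i,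
    ← Finset.add_sum_erase _ _ (Finset.mem_univ i),
    Finset.sum_congr rfl fun l hl => hcross i l (Finset.ne_of_mem_erase hl),
    Finset.sum_const, Finset.card_erase_of_mem (Finset.mem_univ i), Finset.card_univ,
    Fintype.card_fin, nsmul_eq_mul, Nat.cast_sub (Nat.one_le_of_lt i.pos), Nat.cast_one]
  ring

end
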